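/- Let a > b > 0 and b²/a < r < b. Then the area of the set {x ∈ ℝ² : (sphere(x,r) ∩ C(a,b)) has cardinality 2} equals 2πr² + 2πab − 2(A* − F(α)), where A* = πr² + πab − 4raE(ε), F(φ) = 2r²φ + 2ab·arctan((b/a)tanφ) − 4ra·E(φ,ε) + raε² sin(2φ)/√(1−ε² sin²φ), and α = arctan( √(r²a² − b⁴) / (b√(b² − r²)) ). -/

import Mathlib

open Real MeasureTheory Set Metric

noncomputable section

/-- The Euclidean plane. -/
abbrev E2 := EuclideanSpace ℝ (Fin 2)

/-- Closed elliptical region with semi-axes `a`, `b`. -/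
def Kset (a b : ℝ) : Set E2 := {x | (x 0)^2 / a^2 + (x 1)^2 / b^2 ≤ 1}

/-- The ellipse with semi-axes `a`, `b`. -/
def Cset (a b : ℝ) : Set E2 := {x | (x 0)^2 / a^2 + (x 1)^2 / b^2 = 1}

/-- Incomplete elliptic integral of the second kind `E(φ, ε)`. -/
def Einc (ε φ : ℝ) : ℝ := ∫ θ in (0:ℝ)..φ, Real.sqrt (1 - ε^2 * Real.sin θ^2)

/-- Complete elliptic integral of the second kind `E(ε)`. -/
def Ecomp (ε : ℝ) : ℝ := Einc ε (π/2)

/-- Eccentricity of the ellipse with semi-axes `a ≥ b`. -/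
def ecc (a b : ℝ) : ℝ := Real.sqrt (a^2 - b^2) / a
/-- The antiderivative `F(φ)` from the paper's Lemma 1. -/
def Ffun (a b r φ : ℝ) : ℝ :=
  2*r^2*φ + 2*a*b*Real.arctan ((b/a)*Real.tan φ) - 4*r*a*Einc (ecc a b) φ
    + r*a*(ecc a b)^2 * Real.sin (2*φ) / Real.sqrt (1 - (ecc a b)^2 * Real.sin φ^2)
/-- The quantity `A* = πr² + πab − 4raE(ε)`. -/
def Astar (a b r : ℝ) : ℝ := π*r^2 + π*a*b - 4*r*a*Ecomp (ecc a b)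
/-- The angle `α` from Case 2 of the paper's Lemma 1. -/
def alphaAng (a b r : ℝ) : ℝ :=
  Real.arctan (Real.sqrt (r^2*a^2 - b^4) / (b * Real.sqrt (b^2 - r^2)))

open scoped ENNReal Function in
/-- Area formula with multiplicity, away from the critical points. -/
theorem lintegral_count_fiber {E : Type*} [NormedAddCommGroup E] [NormedSpace ℝ E]
    [FiniteDimensional ℝ E] [MeasurableSpace E] [BorelSpace E] (μ : Measure E)
    [μ.IsAddHaarMeasure] {f : E → E} {f' : E → E →L[ℝ] E} {s : Set E} (hs : MeasurableSet s)
    (hf' : ∀ x ∈ s, HasFDerivAt f (f' x) x) (hdet : ∀ x ∈ s, (f' x).det ≠ 0) :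
    Measurable (fun y => Measure.count (s ∩ f ⁻¹' {y})) ∧
      ∫⁻ y, Measure.count (s ∩ f ⁻¹' {y}) ∂μ = ∫⁻ x in s, ENNReal.ofReal |(f' x).det| ∂μ := by
  classical
  rcases s.eq_empty_or_nonempty with rfl | hne
  · simp
  have key : ∀ A : E →L[ℝ] E, ∃ c : NNReal, c ≠ 0 ∧
      (A.det ≠ 0 → ∀ t : Set E, ApproximatesLinearOn f A t c → InjOn f t) := by
    intro A
    by_cases hA : A.det = 0
    · exact ⟨1, one_ne_zero, fun h => absurd hA h⟩
    · let B := A.toContinuousLinearEquivOfDetNeZero hA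
      have hB : (B : E →L[ℝ] E) = A := by ext x; rfl
      by_cases hE : Subsingleton E
      · exact ⟨1, one_ne_zero, fun _ t _ x _ y _ _ => Subsingleton.elim x y⟩
      · have hpos : ‖(B.symm : E →L[ℝ] E)‖₊⁻¹ ≠ 0 := by
          have := B.subsingleton_or_nnnorm_symm_pos.resolve_left hE
          exact (inv_pos.2 this).ne'
        refine ⟨‖(B.symm : E →L[ℝ] E)‖₊⁻¹ / 2, by simpa using hpos, fun _ t ht => ?_⟩
        rw [← hB] at ht
        exact ht.injOn (Or.inr (NNReal.half_lt_self hpos))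
  choose ρ hρ0 hρ using key
  obtain ⟨t, A, tdisj, tmeas, tcov, tapp, tA⟩ :=
    exists_partition_approximatesLinearOn_of_hasFDerivWithinAt f s f'
      (fun x hx => (hf' x hx).hasFDerivWithinAt) ρ hρ0
  have hinj : ∀ n, InjOn f (s ∩ t n) := fun n => by
    obtain ⟨y, hy, hAy⟩ := tA hne n
    exact hρ (A n) (hAy ▸ hdet y hy) _ (tapp n)
  have hst : s = ⋃ n, s ∩ t n := by
    rw [← inter_iUnion, inter_eq_left.2 tcov]
  have hder : ∀ n, ∀ x ∈ s ∩ t n, HasFDerivWithinAt f (f' x) (s ∩ t n) x := fun n x hx =>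
    (hf' x hx.1).hasFDerivWithinAt
  have himg : ∀ n, MeasurableSet (f '' (s ∩ t n)) := fun n =>
    measurable_image_of_fderivWithin (hs.inter (tmeas n)) (hder n) (hinj n)
  have hdisj : Pairwise (Disjoint on fun n => s ∩ t n) := fun i j hij =>
    (tdisj hij).mono inter_subset_right inter_subset_right
  have hsub : ∀ n y, (s ∩ t n ∩ f ⁻¹' {y}).Subsingleton := by
    rintro n y u ⟨hu, hu'⟩ v ⟨hv, hv'⟩
    exact hinj n hu hv (hu'.trans hv'.symm)
  have hcount : ∀ y, Measure.count (s ∩ f ⁻¹' {y}) =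
      ∑' n, (f '' (s ∩ t n)).indicator (1 : E → ℝ≥0∞) y := by
    intro y
    conv_lhs => rw [hst, iUnion_inter]
    rw [measure_iUnion]
    · congr 1
      ext n
      by_cases hy : y ∈ f '' (s ∩ t n)
      · obtain ⟨x, hx, rfl⟩ := hy
        rw [(hsub n (f x)).eq_singleton_of_mem ⟨hx, rfl⟩, Measure.count_singleton,
          indicator_of_mem (mem_image_of_mem f hx), Pi.one_apply]
      · rw [indicator_of_notMem hy]
        have : s ∩ t n ∩ f ⁻¹' {y} = ∅ := by
          ext x
          simp only [mem_inter_iff, mem_preimage, mem_singleton_iff, mem_empty_iff_false,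
            iff_false, not_and]
          exact fun hx h => hy ⟨x, hx, h⟩
        rw [this, measure_empty]
    · exact fun i j hij => (hdisj hij).mono inter_subset_left inter_subset_left
    · exact fun n => (hsub n y).measurableSet
  have hmeas : ∀ n, Measurable ((f '' (s ∩ t n)).indicator (1 : E → ℝ≥0∞)) := fun n =>
    measurable_one.indicator (himg n)
  simp_rw [hcount]
  refine ⟨Measurable.tsum hmeas, ?_⟩
  rw [lintegral_tsum fun n => (hmeas n).aemeasurable]
  conv_rhs => rw [hst, lintegral_iUnion (fun n => hs.inter (tmeas n)) hdisj]
  congr 1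
  ext n
  rw [lintegral_indicator_one (himg n),
    lintegral_abs_det_fderiv_eq_addHaar_image μ (hs.inter (tmeas n)) (hder n) (hinj n)]

open Polynomial in
theorem Polynomial.exists_isRoot_of_odd_natDegree {q : ℝ[X]} (hodd : Odd q.natDegree) :
    ∃ x, q.IsRoot x := by
  wlog hlc : 0 ≤ q.leadingCoeff generalizing q
  · obtain ⟨x, hx⟩ := @this (-q) (by simpa using hodd)
      (by rw [leadingCoeff_neg]; linarith)
    exact ⟨x, by simpa [IsRoot] using hx⟩
  have hdeg : 0 < q.degree := natDegree_pos_iff_degree_pos.1 hodd.pos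
  have hX : (-X : ℝ[X]).natDegree = 1 := by simp
  have hcomp : 0 < (q.comp (-X)).degree := by
    rw [← natDegree_pos_iff_degree_pos, natDegree_comp, hX, mul_one]
    exact hodd.pos
  have hneg : (q.comp (-X)).leadingCoeff ≤ 0 := by
    rw [leadingCoeff_comp (by simp [hX])]
    simp [hodd.neg_one_pow, hlc]
  obtain ⟨x, hx⟩ :=
    ((tendsto_atTop_of_leadingCoeff_nonneg q hdeg hlc).eventually_ge_atTop 0).exists
  obtain ⟨y, hy⟩ :=
    ((tendsto_atBot_of_leadingCoeff_nonpos _ hcomp hneg).eventually_le_atBot 0).exists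
  rw [eval_comp, eval_neg, eval_X] at hy
  exact mem_range_of_exists_le_of_exists_ge q.continuous ⟨-y, hy⟩ ⟨x, hx⟩

open Polynomial in
theorem Polynomial.even_natDegree_of_roots_eq_zero {q : ℝ[X]} (hq : q.roots = 0) :
    Even q.natDegree := by
  by_cases h0 : q = 0
  · simp [h0]
  by_contra hodd
  obtain ⟨x, hx⟩ := exists_isRoot_of_odd_natDegree (Nat.not_even_iff_odd.1 hodd)
  have := (mem_roots h0).2 hx
  simp [hq] at this

open Polynomial in
theorem Polynomial.even_card_rootSet {p : ℝ[X]} (h0 : p ≠ 0) (hdeg : Even p.natDegree)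
    (hsimple : ∀ x, p.IsRoot x → ¬ (derivative p).IsRoot x) :
    Even {x | p.IsRoot x}.ncard ∧ {x | p.IsRoot x}.ncard ≤ p.natDegree ∧
      {x | p.IsRoot x}.Finite := by
  classical
  have hset : {x | p.IsRoot x} = (p.roots.toFinset : Set ℝ) := by
    ext x
    simp [h0]
  have hnd : p.roots.Nodup := by
    rw [Multiset.nodup_iff_count_le_one]
    intro x
    rw [count_roots]
    by_contra! h
    obtain ⟨h1, h2⟩ := (one_lt_rootMultiplicity_iff_isRoot h0).1 h
    exact hsimple x h1 h2
  obtain ⟨q, -, hq1, hq2⟩ := exists_prod_multiset_X_sub_C_mul p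
  have hcard : {x | p.IsRoot x}.ncard = Multiset.card p.roots := by
    rw [hset, ncard_coe_finset, Multiset.toFinset_card_of_nodup hnd]
  rw [hcard]
  refine ⟨?_, by omega, hset ▸ Finset.finite_toSet _⟩
  have := even_natDegree_of_roots_eq_zero hq2
  rw [← hq1] at hdeg
  exact (Nat.even_add.1 hdeg).2 this

/-- Points of the ellipse at distance `r` from `z`, in coordinates. -/
def hitSet (a b r : ℝ) (z : ℝ × ℝ) : Set (ℝ × ℝ) :=
  {w | w.1^2 / a^2 + w.2^2 / b^2 = 1 ∧ (w.1 - z.1)^2 + (w.2 - z.2)^2 = r^2}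

open Polynomial in
theorem even_ncard_hitSet {a b r : ℝ} (ha : 0 < a) (hb : 0 < b) {z : ℝ × ℝ}
    (hz : (-a, 0) ∉ hitSet a b r z)
    (htan : ∀ w ∈ hitSet a b r z, a^2 * (w.1 - z.1) * w.2 ≠ b^2 * (w.2 - z.2) * w.1) :
    Even (hitSet a b r z).ncard ∧ (hitSet a b r z).ncard ≤ 4 ∧ (hitSet a b r z).Finite := by
  obtain ⟨p, q⟩ := z
  have hlead : (a + p)^2 + q^2 - r^2 ≠ 0 := by
    intro h
    apply hz
    refine ⟨?_, ?_⟩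
    · simp [ha.ne']
    · simp only; linarith
  set P : ℝ[X] := C ((a + p)^2 + q^2 - r^2) * X^4 + C (-4*b*q) * X^3 +
    C (-2*(a-p)*(a+p) + 4*b^2 + 2*q^2 - 2*r^2) * X^2 + C (-4*b*q) * X +
    C ((a - p)^2 + q^2 - r^2) with hP
  have hdeg : P.natDegree = 4 := by
    rw [hP]
    compute_degree!
  have hP0 : P ≠ 0 := by
    intro h
    rw [h] at hdeg
    simp at hdeg
  have heval : ∀ u, P.eval u = (a*(1-u^2) - p*(1+u^2))^2 + (2*b*u - q*(1+u^2))^2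
      - r^2*(1+u^2)^2 := by
    intro u
    simp only [hP, eval_add, eval_mul, eval_C, eval_pow, eval_X]
    ring
  have hderiv : ∀ u, (derivative P).eval u = 2*(a*(1-u^2) - p*(1+u^2))*(-2*u*(a+p))
      + 2*(2*b*u - q*(1+u^2))*(2*b-2*q*u) - 4*r^2*u*(1+u^2) := by
    intro u
    simp only [hP, derivative_add, derivative_mul, derivative_C, derivative_X_pow, derivative_X,
      eval_add, eval_mul, eval_C, eval_pow, eval_X, eval_zero, eval_one]
    norm_num
    ring
  set ψ : ℝ → ℝ × ℝ := fun u => (a*(1-u^2)/(1+u^2), 2*b*u/(1+u^2)) with hψ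
  have hD : ∀ u : ℝ, 1 + u^2 ≠ 0 := fun u => by positivity
  have hmem : ∀ u, P.IsRoot u → ψ u ∈ hitSet a b r (p, q) := by
    intro u hu
    rw [IsRoot, heval] at hu
    have := hD u
    refine ⟨?_, ?_⟩
    · simp only [hψ]
      field_simp
      ring
    · simp only [hψ]
      field_simp
      linear_combination hu
  have hinj : Function.Injective ψ := by
    intro u v huv
    simp only [hψ, Prod.mk.injEq] at huv
    obtain ⟨h1, h2⟩ := huv
    have hu := hD u
    have hv := hD v
    field_simp at h1 h2
    have h3 : u^2 = v^2 := by linarith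
    rw [h3] at h2
    exact mul_right_cancel₀ hv (h2.trans (mul_comm _ _))
  have himg : hitSet a b r (p, q) = ψ '' {u | P.IsRoot u} := by
    ext ⟨x, y⟩
    constructor
    · rintro ⟨h1, h2⟩
      simp only at h1 h2
      have hx : a + x ≠ 0 := by
        intro hx
        have hx' : x = -a := by linarith
        subst hx'
        have hy : y = 0 := by
          have : (-a)^2/a^2 = 1 := by field_simp
          rw [this] at h1
          have h3 : y^2/b^2 = 0 := by linarith
          have hb' : b^2 ≠ 0 := by positivity
          simpa [hb.ne'] using h3
        subst hy
        exact hz ⟨by simp [ha.ne'], h2⟩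
      have hE : y^2*a^2 = b^2*(a-x)*(a+x) := by
        field_simp at h1
        linear_combination h1
      have hE2 : y^2 = b^2*(a-x)*(a+x)/a^2 := by
        field_simp; linarith
      have hu : 1 + (y*a/(b*(a+x)))^2 = 2*a/(a+x) := by
        rw [div_pow, mul_pow, hE]
        field_simp
        ring
      have hu' : 1 - (y*a/(b*(a+x)))^2 = 2*x/(a+x) := by
        rw [div_pow, mul_pow, hE]
        field_simp
        ring
      have hψu : ψ (y*a/(b*(a+x))) = (x, y) := by
        simp only [hψ, hu, hu']
        ext
        · simp only; field_simp
        · simp only; field_simp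
      refine ⟨y*a/(b*(a+x)), ?_, hψu⟩
      simp only [mem_ofPred_eq, IsRoot, heval, hu, hu']
      field_simp
      linear_combination 4 * a^2 * h2
    · rintro ⟨u, hu, huv⟩
      rw [← huv]
      exact hmem u hu
  have hsimple : ∀ u, P.IsRoot u → ¬ (derivative P).IsRoot u := by
    intro u hu hu'
    refine htan _ (hmem u hu) ?_
    rw [IsRoot, heval] at hu
    rw [IsRoot, hderiv] at hu'
    have := hD u
    simp only [hψ]
    field_simp
    linear_combination (-(1+u^2)/4) * hu' + u * hu
  have := P.even_card_rootSet hP0 (by rw [hdeg]; decide) hsimple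
  rw [himg, ncard_image_of_injective _ hinj]
  rw [hdeg] at this
  exact ⟨this.1, this.2.1, this.2.2.image ψ⟩

theorem exists_angle {c d : ℝ} (h : c^2 + d^2 = 1) : ∃ φ ∈ Ioc (-π) π, cos φ = c ∧ sin φ = d := by
  have hn : ‖(⟨c, d⟩ : ℂ)‖ = 1 := by
    rw [Complex.norm_def, Complex.normSq_mk, ← sq, ← sq, h, Real.sqrt_one]
  have h0 : (⟨c, d⟩ : ℂ) ≠ 0 := by
    intro h0
    simp [h0] at hn
  refine ⟨Complex.arg ⟨c, d⟩, Complex.arg_mem_Ioc _, ?_, ?_⟩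
  · rw [Complex.cos_arg h0, hn, div_one]
  · rw [Complex.sin_arg, hn, div_one]

theorem angle_unique {φ θ : ℝ} (hφ : φ ∈ Ioc (-π) π) (hθ : θ ∈ Ioc (-π) π)
    (hc : cos φ = cos θ) (hs : sin φ = sin θ) : φ = θ := by
  rw [← Complex.arg_cos_add_sin_mul_I hφ, ← Complex.arg_cos_add_sin_mul_I hθ,
    ← Complex.ofReal_cos, ← Complex.ofReal_sin, ← Complex.ofReal_cos, ← Complex.ofReal_sin, hc, hs]

/-- The linear map of the plane with matrix `!![A, B; C, D]`. -/
def planeMap (A B C D : ℝ) : ℝ × ℝ →L[ℝ] ℝ × ℝ :=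
  (A • ContinuousLinearMap.fst ℝ ℝ ℝ + B • ContinuousLinearMap.snd ℝ ℝ ℝ).prod
    (C • ContinuousLinearMap.fst ℝ ℝ ℝ + D • ContinuousLinearMap.snd ℝ ℝ ℝ)

theorem planeMap_det (A B C D : ℝ) : (planeMap A B C D).det = A * D - B * C := by
  rw [planeMap, ← Matrix.toLin_finTwoProd_toContinuousLinearMap, LinearMap.det_toContinuousLinearMap,
    LinearMap.det_toLin, Matrix.det_fin_two_of]

/-- The centre of the circle of radius `r` whose point at angle `x.2` is the point of the ellipse
with eccentric anomaly `x.1`. -/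
def circleCenter (a b r : ℝ) (x : ℝ × ℝ) : ℝ × ℝ :=
  (a * cos x.1 - r * cos x.2, b * sin x.1 - r * sin x.2)

/-- The derivative of `circleCenter`. -/
def circleCenterDeriv (a b r : ℝ) (x : ℝ × ℝ) : ℝ × ℝ →L[ℝ] ℝ × ℝ :=
  planeMap (-(a * sin x.1)) (r * sin x.2) (b * cos x.1) (-(r * cos x.2))

theorem hasFDerivAt_circleCenter (a b r : ℝ) (x : ℝ × ℝ) :
    HasFDerivAt (circleCenter a b r) (circleCenterDeriv a b r x) x := by
  have hc1 := (hasDerivAt_cos x.1).comp_hasFDerivAt x (hasFDerivAt_fst (𝕜 := ℝ) (E := ℝ) (F := ℝ))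
  have hc2 := (hasDerivAt_cos x.2).comp_hasFDerivAt x (hasFDerivAt_snd (𝕜 := ℝ) (E := ℝ) (F := ℝ))
  have hs1 := (hasDerivAt_sin x.1).comp_hasFDerivAt x (hasFDerivAt_fst (𝕜 := ℝ) (E := ℝ) (F := ℝ))
  have hs2 := (hasDerivAt_sin x.2).comp_hasFDerivAt x (hasFDerivAt_snd (𝕜 := ℝ) (E := ℝ) (F := ℝ))
  refine HasFDerivAt.congr_fderiv (((hc1.const_mul a).sub (hc2.const_mul r)).prodMk
    ((hs1.const_mul b).sub (hs2.const_mul r))) ?_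
  ext <;> simp [circleCenterDeriv, planeMap]

theorem circleCenterDeriv_det (a b r : ℝ) (x : ℝ × ℝ) :
    (circleCenterDeriv a b r x).det = r * (a * sin x.1 * cos x.2 - b * cos x.1 * sin x.2) := by
  rw [circleCenterDeriv, planeMap_det]
  ring

/-- The parameters at which the circle crosses the ellipse transversally. -/
def transversal (a b r : ℝ) : Set (ℝ × ℝ) :=
  (Ioc (-π) π ×ˢ Ioc (-π) π) ∩ {x | (circleCenterDeriv a b r x).det ≠ 0}

theorem measurableSet_transversal (a b r : ℝ) : MeasurableSet (transversal a b r) := by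
  refine (measurableSet_Ioc.prod measurableSet_Ioc).inter ?_
  simp only [circleCenterDeriv_det]
  refine (measurableSet_eq_fun (g := fun _ => (0:ℝ)) ?_ measurable_const).compl
  fun_prop

theorem exists_ellipse_angle {a b : ℝ} (ha : 0 < a) (hb : 0 < b) {w : ℝ × ℝ}
    (hw : w.1^2 / a^2 + w.2^2 / b^2 = 1) :
    ∃ t ∈ Ioc (-π) π, w.1 = a * cos t ∧ w.2 = b * sin t := by
  obtain ⟨t, ht, hc, hs⟩ := exists_angle (c := w.1 / a) (d := w.2 / b)
    (by rw [div_pow, div_pow, hw])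
  refine ⟨t, ht, ?_, ?_⟩
  · rw [hc]; field_simp
  · rw [hs]; field_simp

theorem exists_circle_angle {r : ℝ} (hr : 0 < r) {w z : ℝ × ℝ}
    (hw : (w.1 - z.1)^2 + (w.2 - z.2)^2 = r^2) :
    ∃ θ ∈ Ioc (-π) π, w.1 - z.1 = r * cos θ ∧ w.2 - z.2 = r * sin θ := by
  obtain ⟨t, ht, hc, hs⟩ := exists_angle (c := (w.1 - z.1) / r) (d := (w.2 - z.2) / r)
    (by rw [div_pow, div_pow, ← add_div, hw]; field_simp)
  refine ⟨t, ht, ?_, ?_⟩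
  · rw [hc]; field_simp
  · rw [hs]; field_simp

theorem ae_count_circleCenter {a b r : ℝ} (ha : 0 < a) (hb : 0 < b) (hr : 0 < r) :
    ∀ᵐ z : ℝ × ℝ, Measure.count (transversal a b r ∩ circleCenter a b r ⁻¹' {z}) =
        (hitSet a b r z).ncard ∧
      Even (hitSet a b r z).ncard ∧ (hitSet a b r z).ncard ≤ 4 ∧ (hitSet a b r z).Finite := by
  have hnull1 : volume (circleCenter a b r '' {x | (circleCenterDeriv a b r x).det = 0}) = 0 :=
    addHaar_image_eq_zero_of_det_fderivWithin_eq_zero _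
      (fun x _ => (hasFDerivAt_circleCenter a b r x).hasFDerivWithinAt) (fun x hx => hx)
  have hnull2 : volume {z | (-a, 0) ∈ hitSet a b r z} = 0 := by
    set f : ℝ × ℝ → ℝ × ℝ := fun x => circleCenter a b r (π, x.2)
    have hf : ∀ x, HasFDerivAt f ((circleCenterDeriv a b r (π, x.2)).comp
        ((0 : ℝ × ℝ →L[ℝ] ℝ).prod (ContinuousLinearMap.snd ℝ ℝ ℝ))) x := fun x =>
      HasFDerivAt.comp (f := fun x : ℝ × ℝ => (π, x.2)) x (hasFDerivAt_circleCenter a b r (π, x.2))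
        ((hasFDerivAt_const π x).prodMk hasFDerivAt_snd)
    refine measure_mono_null ?_ (addHaar_image_eq_zero_of_det_fderivWithin_eq_zero volume
      (s := univ) (f := f) (fun x _ => (hf x).hasFDerivWithinAt) (fun x _ => ?_))
    · rintro z ⟨-, hz⟩
      obtain ⟨θ, -, h1, h2⟩ := exists_circle_angle hr (w := (-a, 0)) hz
      refine ⟨(0, θ), mem_univ _, ?_⟩
      ext
      · simp [f, circleCenter]; linarith
      · simp [f, circleCenter]; linarith
    · change LinearMap.det _ = 0
      rw [ContinuousLinearMap.toLinearMap_comp, LinearMap.det_comp]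
      have : (((0 : ℝ × ℝ →L[ℝ] ℝ).prod (ContinuousLinearMap.snd ℝ ℝ ℝ)) : ℝ × ℝ →ₗ[ℝ] ℝ × ℝ).det
          = 0 := by
        have h := planeMap_det 0 0 0 1
        rw [planeMap] at h
        simpa using! h
      rw [this, mul_zero]
  filter_upwards [measure_eq_zero_iff_ae_notMem.1 hnull1, measure_eq_zero_iff_ae_notMem.1 hnull2]
    with z hz1 hz2
  have hdet : ∀ x, circleCenter a b r x = z → (circleCenterDeriv a b r x).det ≠ 0 :=
    fun x hx h => hz1 ⟨x, h, hx⟩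
  have hpar : ∀ w ∈ hitSet a b r z, ∃ x ∈ Ioc (-π) π ×ˢ Ioc (-π) π, circleCenter a b r x = z ∧
      (w.1 = a * cos x.1 ∧ w.2 = b * sin x.1) ∧
      (w.1 - z.1 = r * cos x.2 ∧ w.2 - z.2 = r * sin x.2) := by
    rintro w ⟨hw1, hw2⟩
    obtain ⟨t, ht, ht1, ht2⟩ := exists_ellipse_angle ha hb hw1
    obtain ⟨θ, hθ, hθ1, hθ2⟩ := exists_circle_angle hr hw2
    refine ⟨(t, θ), ⟨ht, hθ⟩, ?_, ⟨ht1, ht2⟩, ⟨hθ1, hθ2⟩⟩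
    ext
    · simp only [circleCenter]; linarith
    · simp only [circleCenter]; linarith
  have heven := even_ncard_hitSet ha hb (z := z) hz2 (by
    intro w hw h
    obtain ⟨x, -, hx, ⟨h1, h2⟩, h3, h4⟩ := hpar w hw
    apply hdet x hx
    rw [h3, h4, h1, h2] at h
    rw [circleCenterDeriv_det]
    have hab : a * b ≠ 0 := by positivity
    apply mul_left_cancel₀ hab
    linear_combination h)
  refine ⟨?_, heven⟩
  have hbij : BijOn (fun x : ℝ × ℝ => (a * cos x.1, b * sin x.1))
      (transversal a b r ∩ circleCenter a b r ⁻¹' {z}) (hitSet a b r z) := by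
    refine ⟨?_, ?_, ?_⟩
    · rintro x ⟨-, hx⟩
      rw [mem_preimage, mem_singleton_iff] at hx
      subst hx
      refine ⟨?_, ?_⟩
      · simp only
        field_simp
        linear_combination sin_sq_add_cos_sq x.1
      · simp only [circleCenter]
        linear_combination r^2 * sin_sq_add_cos_sq x.2
    · rintro x ⟨⟨hx, -⟩, hxz⟩ y ⟨⟨hy, -⟩, hyz⟩ hxy
      simp only [Prod.mk.injEq] at hxy
      have h1 : x.1 = y.1 := angle_unique hx.1 hy.1 (mul_left_cancel₀ ha.ne' hxy.1)
        (mul_left_cancel₀ hb.ne' hxy.2)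
      have hxy' : circleCenter a b r x = circleCenter a b r y := by
        rw [mem_preimage, mem_singleton_iff] at hxz hyz
        rw [hxz, hyz]
      simp only [circleCenter, Prod.mk.injEq] at hxy'
      refine Prod.ext h1 (angle_unique hx.2 hy.2 ?_ ?_)
      · apply mul_left_cancel₀ hr.ne'; linarith
      · apply mul_left_cancel₀ hr.ne'; linarith
    · intro w hw
      obtain ⟨x, hx, hxz, ⟨h1, h2⟩, -⟩ := hpar w hw
      exact ⟨x, ⟨⟨hx, hdet x hxz⟩, hxz⟩, Prod.ext h1.symm h2.symm⟩
  rw [← hbij.image_eq] at heven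
  rw [← hbij.image_eq, hbij.injOn.ncard_image]
  have hfin := heven.2.2.of_finite_image hbij.injOn
  rw [Measure.count_apply_finite _ hfin, ← ncard_eq_toFinset_card _ hfin]

/-- Tonelli for a planar region whose vertical slices are intervals up to null sets. -/
theorem setLIntegral_of_slices {D : Set (ℝ × ℝ)} (hD : MeasurableSet D) {c d : ℝ} (hcd : c ≤ d)
    {l u : ℝ → ℝ} (hlu : ∀ φ, l φ ≤ u φ) (hD1 : ∀ x ∈ D, x.1 ∈ Ioc c d)
    (hslice : ∀ φ ∈ Ioc c d, {s | (φ, s) ∈ D} =ᵐ[volume] Ioc (l φ) (u φ))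
    {F : ℝ × ℝ → ℝ} (hF : Continuous F)
    (hpos : ∀ φ, ∀ s ∈ Ioc (l φ) (u φ), 0 ≤ F (φ, s)) {G : ℝ → ℝ} (hG : Continuous G)
    (hFG : ∀ φ, ∫ s in (l φ)..(u φ), F (φ, s) = G φ) :
    ∫⁻ x in D, ENNReal.ofReal (F x) = ENNReal.ofReal (∫ φ in c..d, G φ) := by
  have hm : Measurable (fun x => ENNReal.ofReal (F x)) := hF.measurable.ennreal_ofReal
  have hG0 : ∀ φ, 0 ≤ G φ := fun φ => by
    rw [← hFG, intervalIntegral.integral_of_le (hlu φ)]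
    exact setIntegral_nonneg measurableSet_Ioc (hpos φ)
  have hinner : ∀ φ, ∫⁻ s in Ioc (l φ) (u φ), ENNReal.ofReal (F (φ, s)) =
      ENNReal.ofReal (G φ) := by
    intro φ
    rw [← hFG, intervalIntegral.integral_of_le (hlu φ), ofReal_integral_eq_lintegral_ofReal]
    · exact ((hF.comp (by fun_prop : Continuous fun s : ℝ => (φ, s))).intervalIntegrable
        (l φ) (u φ)).1
    · exact (ae_restrict_iff' measurableSet_Ioc).2 (Filter.Eventually.of_forall (hpos φ))
  rw [← lintegral_indicator hD, Measure.volume_eq_prod,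
    lintegral_prod _ (hm.indicator hD).aemeasurable, intervalIntegral.integral_of_le hcd,
    ofReal_integral_eq_lintegral_ofReal (hG.intervalIntegrable c d).1
      (Filter.Eventually.of_forall hG0), ← lintegral_indicator measurableSet_Ioc]
  congr 1
  ext φ
  by_cases hφ : φ ∈ Ioc c d
  · have hDφ : MeasurableSet {s | (φ, s) ∈ D} := hD.preimage measurable_prodMk_left
    rw [indicator_of_mem hφ, ← hinner, ← setLIntegral_congr (hslice φ hφ),
      ← lintegral_indicator hDφ]
    rfl
  · rw [indicator_of_notMem hφ]
    have : ∀ s, D.indicator (fun x => ENNReal.ofReal (F x)) (φ, s) = 0 := fun s =>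
      indicator_of_notMem (fun h => hφ (hD1 _ h)) _
    simp [this]

theorem integral_eq_four_mul_quarter {g : ℝ → ℝ} (hg : Continuous g) (heven : ∀ x, g (-x) = g x)
    (hpi : ∀ x, g (π - x) = g x) : ∫ x in (-π)..π, g x = 4 * ∫ x in (0:ℝ)..(π/2), g x := by
  have hi : ∀ c d, IntervalIntegrable g volume c d := fun c d => hg.intervalIntegrable c d
  rw [← intervalIntegral.integral_add_adjacent_intervals (hi (-π) 0) (hi 0 π)]
  have h1 : ∫ x in (-π)..0, g x = ∫ x in (0:ℝ)..π, g x := by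
    have := intervalIntegral.integral_comp_neg (a := 0) (b := π) g
    simp only [heven, neg_zero] at this
    exact this.symm
  have h2 : ∫ x in (π/2)..π, g x = ∫ x in (0:ℝ)..(π/2), g x := by
    have := intervalIntegral.integral_comp_sub_left (a := 0) (b := π/2) g π
    simp only [hpi, sub_zero] at this
    rw [this]
    congr 1
    ring
  rw [h1, ← intervalIntegral.integral_add_adjacent_intervals (hi 0 (π/2)) (hi (π/2) π), h2]
  ring

theorem integral_abs_cos : ∫ θ in (-π)..π, |cos θ| = 4 := by
  rw [integral_eq_four_mul_quarter (by fun_prop) (by simp) (by simp [cos_pi_sub])]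
  have : ∫ x in (0:ℝ)..(π/2), |cos x| = ∫ x in (0:ℝ)..(π/2), cos x := by
    apply intervalIntegral.integral_congr
    intro x hx
    rw [uIcc_of_le (by positivity)] at hx
    exact abs_of_nonneg (cos_nonneg_of_mem_Icc ⟨by linarith [hx.1, pi_pos], hx.2⟩)
  rw [this]
  simp

theorem integral_abs_add_cos_sin (A B : ℝ) :
    ∫ θ in (-π)..π, |A * cos θ + B * sin θ| = 4 * √(A^2 + B^2) := by
  by_cases h0 : A^2 + B^2 = 0
  · have hA : A = 0 := by nlinarith [sq_nonneg A, sq_nonneg B]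
    have hB : B = 0 := by nlinarith [sq_nonneg A, sq_nonneg B]
    simp [hA, hB]
  have hpos : 0 < A^2 + B^2 := lt_of_le_of_ne (by positivity) (Ne.symm h0)
  set w := √(A^2 + B^2) with hw
  have hwpos : 0 < w := Real.sqrt_pos.2 hpos
  have hw2 : w^2 = A^2 + B^2 := Real.sq_sqrt hpos.le
  obtain ⟨δ, -, hc, hs⟩ := exists_angle (c := A / w) (d := B / w) (by
    rw [div_pow, div_pow, ← add_div, hw2, div_self h0])
  have hA : A = w * cos δ := by rw [hc]; field_simp
  have hB : B = w * sin δ := by rw [hs]; field_simp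
  have heq : ∀ θ, |A * cos θ + B * sin θ| = w * |cos (θ - δ)| := by
    intro θ
    rw [cos_sub, hA, hB, ← abs_of_pos hwpos, ← abs_mul, abs_of_pos hwpos]
    ring_nf
  simp_rw [heq]
  rw [intervalIntegral.integral_const_mul,
    intervalIntegral.integral_comp_sub_right (fun x => |cos x|)]
  have hper : Function.Periodic (fun x => |cos x|) (2 * π) := fun x => by simp
  have := hper.intervalIntegral_add_eq (-π - δ) (-π)
  rw [show -π - δ + 2 * π = π - δ by ring, show -π + 2 * π = π by ring, integral_abs_cos] at this
  rw [this]
  ring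

/-- The support function of the elliptical region. -/
def ellSupport (a b φ : ℝ) : ℝ := √(a^2 * cos φ^2 + b^2 * sin φ^2)

theorem ellSupport_arg_pos {a b : ℝ} (ha : 0 < a) (hb : 0 < b) (φ : ℝ) :
    0 < a^2 * cos φ^2 + b^2 * sin φ^2 := by
  have h := sin_sq_add_cos_sq φ
  rcases (sq_nonneg (cos φ)).eq_or_lt with h0 | h0
  · rw [← h0] at h ⊢
    have : sin φ^2 = 1 := by linarith
    rw [this]
    positivity
  · have := mul_nonneg (sq_nonneg b) (sq_nonneg (sin φ))
    positivity

theorem ellSupport_pos {a b : ℝ} (ha : 0 < a) (hb : 0 < b) (φ : ℝ) : 0 < ellSupport a b φ :=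
  Real.sqrt_pos.2 (ellSupport_arg_pos ha hb φ)

theorem ellSupport_sq (a b φ : ℝ) : ellSupport a b φ^2 = a^2 * cos φ^2 + b^2 * sin φ^2 :=
  Real.sq_sqrt (by positivity)

theorem continuous_ellSupport (a b : ℝ) : Continuous (ellSupport a b) := by
  unfold ellSupport
  fun_prop

theorem ellSupport_neg (a b φ : ℝ) : ellSupport a b (-φ) = ellSupport a b φ := by
  simp [ellSupport]

theorem ellSupport_pi_sub (a b φ : ℝ) : ellSupport a b (π - φ) = ellSupport a b φ := by
  simp [ellSupport, cos_pi_sub]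

theorem sq_ecc {a b : ℝ} (hb : 0 < b) (hba : b < a) : ecc a b^2 = (a^2 - b^2) / a^2 := by
  rw [ecc, div_pow, Real.sq_sqrt (by nlinarith)]

theorem sqrt_one_sub_ecc {a b : ℝ} (hb : 0 < b) (hba : b < a) (φ : ℝ) :
    √(1 - ecc a b^2 * sin φ^2) = ellSupport a b φ / a := by
  have ha : 0 < a := hb.trans hba
  rw [sq_ecc hb hba, ellSupport, ← Real.sqrt_sq ha.le, ← Real.sqrt_div' _ (sq_nonneg a),
    Real.sqrt_sq ha.le, cos_sq']
  congr 1
  field_simp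
  ring

theorem mul_Einc {a b : ℝ} (hb : 0 < b) (hba : b < a) (φ : ℝ) :
    a * Einc (ecc a b) φ = ∫ θ in (0:ℝ)..φ, ellSupport a b θ := by
  have ha : a ≠ 0 := (hb.trans hba).ne'
  rw [Einc, ← intervalIntegral.integral_const_mul]
  congr 1
  ext θ
  rw [sqrt_one_sub_ecc hb hba]
  field_simp

theorem setLIntegral_transversal {a b r : ℝ} (hb : 0 < b) (hba : b < a) (hr : 0 < r) :
    ∫⁻ x in transversal a b r, ENNReal.ofReal |(circleCenterDeriv a b r x).det| =
      ENNReal.ofReal (16 * r * a * Ecomp (ecc a b)) := by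
  have hbox : MeasurableSet (Ioc (-π) π ×ˢ Ioc (-π) π) := measurableSet_Ioc.prod measurableSet_Ioc
  have hsub : transversal a b r ⊆ Ioc (-π) π ×ˢ Ioc (-π) π := inter_subset_left
  have h1 : ∫⁻ x in transversal a b r, ENNReal.ofReal |(circleCenterDeriv a b r x).det| =
      ∫⁻ x in Ioc (-π) π ×ˢ Ioc (-π) π, ENNReal.ofReal |(circleCenterDeriv a b r x).det| := by
    conv_rhs => rw [← lintegral_inter_add_sdiff _ _ (measurableSet_transversal a b r)]
    have hz : ∫⁻ x in (Ioc (-π) π ×ˢ Ioc (-π) π) \ transversal a b r,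
        ENNReal.ofReal |(circleCenterDeriv a b r x).det| = 0 := by
      refine setLIntegral_eq_zero (hbox.diff (measurableSet_transversal a b r)) ?_
      rintro x ⟨hx, hx'⟩
      have : (circleCenterDeriv a b r x).det = 0 := by
        by_contra h
        exact hx' ⟨hx, h⟩
      simp [this]
    rw [inter_eq_right.2 hsub, hz, add_zero]
  have hpi : -π ≤ π := by linarith [pi_pos]
  rw [h1, setLIntegral_of_slices hbox hpi (l := fun _ => -π) (u := fun _ => π) (fun _ => hpi)
    (fun x hx => hx.1) (fun φ hφ => ?_) (G := fun t => 4 * r * ellSupport a b (π/2 - t)) ?_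
    (fun φ s _ => abs_nonneg _) ?_ ?_]
  · have hc := continuous_ellSupport a b
    rw [intervalIntegral.integral_const_mul, integral_eq_four_mul_quarter (by fun_prop),
      intervalIntegral.integral_comp_sub_left (fun x => ellSupport a b x)]
    · simp only [sub_self, sub_zero]
      rw [← mul_Einc hb hba]
      congr 1
      simp only [Ecomp]
      ring
    · intro x
      rw [← ellSupport_pi_sub]
      congr 1
      ring
    · intro x
      rw [← ellSupport_neg]
      congr 1
      ring
  · simp only [circleCenterDeriv_det]
    fun_prop
  · have := continuous_ellSupport a b
    fun_prop
  · intro t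
    have : ∀ s, |(circleCenterDeriv a b r (t, s)).det| =
        r * |(a * sin t) * cos s + (-(b * cos t)) * sin s| := fun s => by
      rw [circleCenterDeriv_det, abs_mul, abs_of_pos hr]
      ring_nf
    simp_rw [this]
    rw [intervalIntegral.integral_const_mul, integral_abs_add_cos_sin, ellSupport, cos_pi_div_two_sub,
      sin_pi_div_two_sub]
    ring_nf
  · have : {s | (φ, s) ∈ Ioc (-π) π ×ˢ Ioc (-π) π} = Ioc (-π) π := by
      ext s
      simp [mem_prod, hφ.1, hφ.2]
    rw [this]
    exact Filter.EventuallyEq.rfl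

/-- The radius of curvature of the ellipse at the point with normal angle `φ`. -/
def curvRadius (a b φ : ℝ) : ℝ := a^2 * b^2 / ellSupport a b φ^3

/-- The point at signed distance `x.2` along the inner normal of the ellipse at the point with
normal angle `x.1`. -/
def normalPoint (a b : ℝ) (x : ℝ × ℝ) : ℝ × ℝ :=
  ((a^2 / ellSupport a b x.1 - x.2) * cos x.1, (b^2 / ellSupport a b x.1 - x.2) * sin x.1)

/-- The derivative of `normalPoint`. -/
def normalPointDeriv (a b : ℝ) (x : ℝ × ℝ) : ℝ × ℝ →L[ℝ] ℝ × ℝ :=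
  planeMap (-(curvRadius a b x.1 - x.2) * sin x.1) (-cos x.1)
    ((curvRadius a b x.1 - x.2) * cos x.1) (-sin x.1)

theorem hasDerivAt_ellSupport {a b : ℝ} (ha : 0 < a) (hb : 0 < b) (φ : ℝ) :
    HasDerivAt (ellSupport a b) (-((a^2 - b^2) * sin φ * cos φ / ellSupport a b φ)) φ := by
  have h1 := (((hasDerivAt_cos φ).pow 2).const_mul (a^2)).add
    (((hasDerivAt_sin φ).pow 2).const_mul (b^2))
  have := h1.sqrt (ellSupport_arg_pos ha hb φ).ne'
  refine this.congr_deriv ?_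
  have hpos := ellSupport_pos ha hb φ
  change _ / (2 * ellSupport a b φ) = _
  field_simp
  ring

theorem hasDerivAt_normal_fst {a b : ℝ} (ha : 0 < a) (hb : 0 < b) (φ : ℝ) :
    HasDerivAt (fun φ => a^2 / ellSupport a b φ * cos φ) (-(curvRadius a b φ * sin φ)) φ := by
  have hpos := ellSupport_pos ha hb φ
  refine ((((hasDerivAt_const φ (a^2)).div (hasDerivAt_ellSupport ha hb φ) hpos.ne')).mul
    (hasDerivAt_cos φ)).congr_deriv ?_
  simp only [curvRadius, Pi.div_apply]
  field_simp
  rw [ellSupport_sq]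
  linear_combination (-a^2 * b^2 * sin φ) * sin_sq_add_cos_sq φ

theorem hasDerivAt_normal_snd {a b : ℝ} (ha : 0 < a) (hb : 0 < b) (φ : ℝ) :
    HasDerivAt (fun φ => b^2 / ellSupport a b φ * sin φ) (curvRadius a b φ * cos φ) φ := by
  have hpos := ellSupport_pos ha hb φ
  refine ((((hasDerivAt_const φ (b^2)).div (hasDerivAt_ellSupport ha hb φ) hpos.ne')).mul
    (hasDerivAt_sin φ)).congr_deriv ?_
  simp only [curvRadius, Pi.div_apply]
  field_simp
  rw [ellSupport_sq]
  linear_combination (a^2 * b^2 * cos φ) * sin_sq_add_cos_sq φ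

theorem hasFDerivAt_normalPoint {a b : ℝ} (ha : 0 < a) (hb : 0 < b) (x : ℝ × ℝ) :
    HasFDerivAt (normalPoint a b) (normalPointDeriv a b x) x := by
  have hf := hasFDerivAt_fst (𝕜 := ℝ) (E := ℝ) (F := ℝ) (p := x)
  have hs := hasFDerivAt_snd (𝕜 := ℝ) (E := ℝ) (F := ℝ) (p := x)
  have h1 := (hasDerivAt_normal_fst ha hb x.1).comp_hasFDerivAt x hf
  have h2 := (hasDerivAt_normal_snd ha hb x.1).comp_hasFDerivAt x hf
  have hc := (hasDerivAt_cos x.1).comp_hasFDerivAt x hf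
  have hn := (hasDerivAt_sin x.1).comp_hasFDerivAt x hf
  have heq : normalPoint a b = fun x => (a^2 / ellSupport a b x.1 * cos x.1 - x.2 * cos x.1,
      b^2 / ellSupport a b x.1 * sin x.1 - x.2 * sin x.1) := by
    ext x <;> simp only [normalPoint] <;> ring
  rw [heq]
  refine HasFDerivAt.congr_fderiv ((h1.sub (hs.mul hc)).prodMk (h2.sub (hs.mul hn))) ?_
  ext <;> simp [normalPointDeriv, planeMap] <;> ring

theorem normalPointDeriv_det (a b : ℝ) (x : ℝ × ℝ) :
    (normalPointDeriv a b x).det = curvRadius a b x.1 - x.2 := by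
  rw [normalPointDeriv, planeMap_det]
  linear_combination (curvRadius a b x.1 - x.2) * sin_sq_add_cos_sq x.1

theorem ellSupport_le {a b : ℝ} (hb : 0 < b) (hba : b < a) (φ : ℝ) : ellSupport a b φ ≤ a := by
  rw [ellSupport]
  refine Real.sqrt_le_iff.2 ⟨(hb.trans hba).le, ?_⟩
  have := sin_sq_add_cos_sq φ
  nlinarith [mul_nonneg (sq_nonneg (sin φ)) (by nlinarith : 0 ≤ a^2 - b^2)]

theorem curvRadius_ge {a b : ℝ} (hb : 0 < b) (hba : b < a) (φ : ℝ) :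
    b^2 / ellSupport a b φ ≤ curvRadius a b φ := by
  have hpos := ellSupport_pos (hb.trans hba) hb φ
  have hle := ellSupport_le hb hba φ
  rw [curvRadius, div_le_div_iff₀ hpos (by positivity)]
  have : ellSupport a b φ^2 ≤ a^2 := by gcongr
  have h2 : 0 ≤ b^2 * ellSupport a b φ := by positivity
  nlinarith

/-- The normal angles, with signed distances that stop short of the major axis. -/
def normalDomain (a b : ℝ) : Set (ℝ × ℝ) :=
  {x | x.1 ∈ Ioc (-π) π ∧ x.2 < b^2 / ellSupport a b x.1}

/-- Coordinates of `normalPoint`, solved for the foot of the normal. -/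
theorem normalPoint_foot {a b : ℝ} (hb : 0 < b) (hba : b < a) {x : ℝ × ℝ}
    (hx : x.2 < b^2 / ellSupport a b x.1) :
    x.2 * ellSupport a b x.1 < b^2 ∧
    cos x.1 / ellSupport a b x.1 =
      (normalPoint a b x).1 / (a^2 - x.2 * ellSupport a b x.1) ∧
    sin x.1 / ellSupport a b x.1 =
      (normalPoint a b x).2 / (b^2 - x.2 * ellSupport a b x.1) := by
  have hpos := ellSupport_pos (hb.trans hba) hb x.1
  have h1 : x.2 * ellSupport a b x.1 < b^2 := (lt_div_iff₀ hpos).1 hx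
  have h2 : b^2 < a^2 := by nlinarith
  have h3 : b^2 - x.2 * ellSupport a b x.1 ≠ 0 := by linarith
  have h4 : a^2 - x.2 * ellSupport a b x.1 ≠ 0 := by linarith
  refine ⟨h1, ?_, ?_⟩
  · rw [eq_div_iff h4]
    simp only [normalPoint]
    field_simp
  · rw [eq_div_iff h3]
    simp only [normalPoint]
    field_simp

theorem foot_mem_ellipse {a b : ℝ} (ha : 0 < a) (hb : 0 < b) (φ : ℝ) :
    a^2 * (cos φ / ellSupport a b φ)^2 + b^2 * (sin φ / ellSupport a b φ)^2 = 1 := by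
  have hpos := ellSupport_pos ha hb φ
  rw [div_pow, div_pow]
  field_simp
  rw [ellSupport_sq]

theorem sq_div_sub_le {c p μ ν : ℝ} (h1 : μ < ν) (h2 : ν < c) :
    (p / (c - μ))^2 ≤ (p / (c - ν))^2 := by
  rw [div_pow, div_pow]
  have : 0 < c - ν := by linarith
  gcongr

theorem sq_div_sub_lt {c p μ ν : ℝ} (hp : p ≠ 0) (h1 : μ < ν) (h2 : ν < c) :
    (p / (c - μ))^2 < (p / (c - ν))^2 := by
  rw [div_pow, div_pow]
  have : 0 < c - ν := by linarith
  have : 0 < p^2 := by positivity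
  gcongr

theorem confocal_lt {a b p q μ ν : ℝ} (ha : 0 < a) (hb : 0 < b) (hab : b^2 < a^2)
    (h1 : μ < ν) (h2 : ν < b^2)
    (h3 : a^2 * (p / (a^2 - μ))^2 + b^2 * (q / (b^2 - μ))^2 = 1) :
    a^2 * (p / (a^2 - μ))^2 + b^2 * (q / (b^2 - μ))^2 <
      a^2 * (p / (a^2 - ν))^2 + b^2 * (q / (b^2 - ν))^2 := by
  have h4 := h2.trans hab
  have ha2 : 0 < a^2 := by positivity
  have hb2 : 0 < b^2 := by positivity
  by_cases hq : q = 0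
  · have hp : p ≠ 0 := by
      rintro rfl
      simp [hq] at h3
    exact add_lt_add_of_lt_of_le (mul_lt_mul_of_pos_left (sq_div_sub_lt hp h1 h4) ha2)
      (mul_le_mul_of_nonneg_left (sq_div_sub_le h1 h2) hb2.le)
  · exact add_lt_add_of_le_of_lt (mul_le_mul_of_nonneg_left (sq_div_sub_le h1 h4) ha2.le)
      (mul_lt_mul_of_pos_left (sq_div_sub_lt hq h1 h2) hb2)

theorem injOn_normalPoint {a b : ℝ} (hb : 0 < b) (hba : b < a) :
    InjOn (normalPoint a b) (normalDomain a b) := by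
  have ha := hb.trans hba
  intro x hx y hy hxy
  obtain ⟨hx1, hx2⟩ := hx
  obtain ⟨hy1, hy2⟩ := hy
  obtain ⟨hμ, hc, hs⟩ := normalPoint_foot hb hba hx2
  obtain ⟨hν, hc', hs'⟩ := normalPoint_foot hb hba hy2
  have hX := foot_mem_ellipse ha hb x.1
  have hY := foot_mem_ellipse ha hb y.1
  rw [hc, hs] at hX
  rw [hc', hs', ← hxy] at hY
  have hpx := ellSupport_pos ha hb x.1
  have hpy := ellSupport_pos ha hb y.1
  generalize hz : normalPoint a b x = z at *
  obtain ⟨p, q⟩ := z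
  simp only at *
  have hab : b^2 < a^2 := by nlinarith
  have hmono : ∀ μ ν : ℝ, μ < ν → ν < b^2 →
      a^2 * (p / (a^2 - μ))^2 + b^2 * (q / (b^2 - μ))^2 = 1 →
      a^2 * (p / (a^2 - ν))^2 + b^2 * (q / (b^2 - ν))^2 ≠ 1 :=
    fun μ ν h1 h2 h3 => (h3 ▸ confocal_lt ha hb hab h1 h2 h3).ne'
  have hμν : x.2 * ellSupport a b x.1 = y.2 * ellSupport a b y.1 := by
    rcases lt_trichotomy (x.2 * ellSupport a b x.1) (y.2 * ellSupport a b y.1) with h | h | h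
    · exact absurd hY (hmono _ _ h hν hX)
    · exact h
    · exact absurd hX (hmono _ _ h hμ hY)
  rw [← hxy] at hc' hs'
  rw [← hμν] at hc' hs'
  have hcc : cos x.1 / ellSupport a b x.1 = cos y.1 / ellSupport a b y.1 := hc.trans hc'.symm
  have hss : sin x.1 / ellSupport a b x.1 = sin y.1 / ellSupport a b y.1 := hs.trans hs'.symm
  have hh : ellSupport a b x.1 = ellSupport a b y.1 := by
    have e1 : (cos x.1 / ellSupport a b x.1)^2 + (sin x.1 / ellSupport a b x.1)^2 =
        1 / ellSupport a b x.1^2 := by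
      rw [div_pow, div_pow, ← add_div, cos_sq_add_sin_sq]
    have e2 : (cos y.1 / ellSupport a b y.1)^2 + (sin y.1 / ellSupport a b y.1)^2 =
        1 / ellSupport a b y.1^2 := by
      rw [div_pow, div_pow, ← add_div, cos_sq_add_sin_sq]
    rw [hcc, hss, e2] at e1
    have e3 : ellSupport a b x.1^2 = ellSupport a b y.1^2 := by
      field_simp at e1
      exact e1
    exact (pow_left_inj₀ hpx.le hpy.le two_ne_zero).1 e3
  rw [hh] at hcc hss hμν
  refine Prod.ext (angle_unique hx1 hy1 ?_ ?_) (mul_right_cancel₀ hpy.ne' hμν)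
  · exact (div_left_inj' hpy.ne').1 hcc
  · exact (div_left_inj' hpy.ne').1 hss

theorem exists_normalPoint {a b : ℝ} (hb : 0 < b) (hba : b < a) {z : ℝ × ℝ} (hz : z.2 ≠ 0) :
    ∃ x ∈ normalDomain a b, normalPoint a b x = z := by
  have ha := hb.trans hba
  obtain ⟨p, q⟩ := z
  simp only at hz
  have hab : b^2 < a^2 := by nlinarith
  have hq : 0 < |q| := abs_pos.2 hz
  have hp := abs_nonneg p
  have hle : -(2*a*|p| + 2*b*|q|) ≤ b^2 - b*|q| := by
    have : 0 ≤ a*|p| := by positivity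
    have : 0 ≤ b*|q| := by positivity
    nlinarith
  have hlt : b^2 - b*|q| < b^2 := by
    have : 0 < b*|q| := by positivity
    linarith
  have hcont : ContinuousOn (fun μ => a^2 * (p / (a^2 - μ))^2 + b^2 * (q / (b^2 - μ))^2)
      (Icc (-(2*a*|p| + 2*b*|q|)) (b^2 - b*|q|)) := by
    have h1 : ∀ μ ∈ Icc (-(2*a*|p| + 2*b*|q|)) (b^2 - b*|q|), a^2 - μ ≠ 0 := fun μ hμ => by
      have := hμ.2; linarith
    have h2 : ∀ μ ∈ Icc (-(2*a*|p| + 2*b*|q|)) (b^2 - b*|q|), b^2 - μ ≠ 0 := fun μ hμ => by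
      have := hμ.2; linarith
    fun_prop (disch := assumption)
  have hlo : a^2 * (p / (a^2 - -(2*a*|p| + 2*b*|q|)))^2 +
      b^2 * (q / (b^2 - -(2*a*|p| + 2*b*|q|)))^2 ≤ 1 := by
    have h1 : a^2 * (p / (a^2 - -(2*a*|p| + 2*b*|q|)))^2 ≤ 1/4 := by
      rw [← sq_abs (p / _), abs_div, div_pow, mul_div_assoc', div_le_iff₀, sq_abs (_ - _)]
      · have : 2*a*|p| ≤ a^2 - -(2*a*|p| + 2*b*|q|) := by nlinarith [mul_pos hb hq]
        have h3 : (2*a*|p|)^2 ≤ (a^2 - -(2*a*|p| + 2*b*|q|))^2 := by gcongr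
        linarith
      · rw [sq_abs]
        have : 0 < a^2 - -(2*a*|p| + 2*b*|q|) := by nlinarith [mul_nonneg ha.le hp, mul_pos hb hq, sq_pos_of_pos ha]
        positivity
    have h2 : b^2 * (q / (b^2 - -(2*a*|p| + 2*b*|q|)))^2 ≤ 1/4 := by
      rw [← sq_abs (q / _), abs_div, div_pow, mul_div_assoc', div_le_iff₀, sq_abs (_ - _)]
      · have : 2*b*|q| ≤ b^2 - -(2*a*|p| + 2*b*|q|) := by nlinarith [mul_nonneg ha.le hp]
        have h3 : (2*b*|q|)^2 ≤ (b^2 - -(2*a*|p| + 2*b*|q|))^2 := by gcongr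
        linarith
      · rw [sq_abs]
        have : 0 < b^2 - -(2*a*|p| + 2*b*|q|) := by nlinarith [mul_nonneg ha.le hp, mul_pos hb hq, sq_pos_of_pos hb]
        positivity
    linarith
  have hhi : 1 ≤ a^2 * (p / (a^2 - (b^2 - b*|q|)))^2 + b^2 * (q / (b^2 - (b^2 - b*|q|)))^2 := by
    have h2 : b^2 * (q / (b^2 - (b^2 - b*|q|)))^2 = 1 := by
      rw [show b^2 - (b^2 - b*|q|) = b*|q| by ring, div_pow, mul_pow, sq_abs]
      field_simp
    rw [h2]
    nlinarith [mul_nonneg (sq_nonneg a) (sq_nonneg (p / (a^2 - (b^2 - b*|q|))))]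
  obtain ⟨μ, hμ, hμ1⟩ := intermediate_value_Icc hle hcont ⟨hlo, hhi⟩
  simp only at hμ1
  have hμb : μ < b^2 := hμ.2.trans_lt hlt
  have hA : 0 < a^2 - μ := by linarith
  have hB : 0 < b^2 - μ := by linarith
  obtain ⟨C, hC⟩ : ∃ C, C = p / (a^2 - μ) := ⟨_, rfl⟩
  obtain ⟨S, hS⟩ : ∃ S, S = q / (b^2 - μ) := ⟨_, rfl⟩
  rw [← hC, ← hS] at hμ1
  have hS0 : S ≠ 0 := hS ▸ div_ne_zero hz hB.ne'
  have hk2 : 0 < C^2 + S^2 := by positivity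
  set k := √(C^2 + S^2) with hk
  have hkpos : 0 < k := Real.sqrt_pos.2 hk2
  have hksq : k^2 = C^2 + S^2 := Real.sq_sqrt hk2.le
  obtain ⟨φ, hφ, hc, hs⟩ := exists_angle (c := C / k) (d := S / k) (by
    rw [div_pow, div_pow, ← add_div, hksq, div_self hk2.ne'])
  have hh : ellSupport a b φ = 1 / k := by
    rw [ellSupport, hc, hs, div_pow, div_pow, mul_div_assoc', mul_div_assoc', ← add_div, hμ1,
      Real.sqrt_div zero_le_one, Real.sqrt_one, Real.sqrt_sq hkpos.le]
  refine ⟨(φ, μ * k), ⟨hφ, ?_⟩, ?_⟩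
  · simp only [hh]
    rw [div_div_eq_mul_div, div_one]
    gcongr
  · simp only [normalPoint, hh, hc, hs, hC, hS]
    ext
    · simp only; field_simp
    · simp only; field_simp

theorem hitSet_normalPoint_nonempty_iff {a b r : ℝ} (hb : 0 < b) (hba : b < a) (hr : 0 < r)
    (hrb : r < b) {x : ℝ × ℝ} (hx : x.2 < b^2 / ellSupport a b x.1) :
    (hitSet a b r (normalPoint a b x)).Nonempty ↔ |x.2| ≤ r := by
  have ha := hb.trans hba
  have hpos := ellSupport_pos ha hb x.1
  obtain ⟨hμ, hc, hs⟩ := normalPoint_foot hb hba hx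
  have hfoot := foot_mem_ellipse ha hb x.1
  have hab : b^2 < a^2 := by nlinarith
  obtain ⟨φ, s⟩ := x
  set C := cos φ / ellSupport a b φ with hC
  set S := sin φ / ellSupport a b φ with hS
  set h := ellSupport a b φ with hh
  simp only at *
  have hCS : h^2 * (C^2 + S^2) = 1 := by
    rw [hC, hS, div_pow, div_pow, ← add_div, cos_sq_add_sin_sq]
    field_simp
  clear_value C S h
  have hz1 : (normalPoint a b (φ, s)).1 = (a^2 - s*h) * C := by
    have : a^2 - s*h ≠ 0 := by linarith
    rw [hc]; field_simp
  have hz2 : (normalPoint a b (φ, s)).2 = (b^2 - s*h) * S := by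
    have : b^2 - s*h ≠ 0 := by linarith
    rw [hs]; field_simp
  generalize normalPoint a b (φ, s) = z at *
  obtain ⟨p, q⟩ := z
  simp only at hz1 hz2
  have hdist : (a^2*C - p)^2 + (b^2*S - q)^2 = s^2 := by
    rw [hz1, hz2]
    linear_combination s^2 * hCS
  constructor
  · rintro ⟨⟨u, v⟩, hw1, hw2⟩
    simp only at hw1 hw2
    apply abs_le_of_sq_le_sq _ hr.le
    have hid : (u-p)^2 + (v-q)^2 - s^2 = (1 - s*h/a^2)*(u - a^2*C)^2 + (1 - s*h/b^2)*(v - b^2*S)^2 := by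
      rw [← hdist, hz1, hz2]
      have e1 : u^2 / a^2 + v^2 / b^2 = 1 := hw1
      have e2 : (1 - s*h/a^2)*(u - a^2*C)^2 + (1 - s*h/b^2)*(v - b^2*S)^2 =
          (u - a^2*C)^2 + (v - b^2*S)^2 - s*h*(u^2/a^2 + v^2/b^2 - 2*C*u - 2*S*v
            + (a^2*C^2 + b^2*S^2)) := by
        field_simp
        ring
      rw [e2, e1]
      linear_combination (-(s*h)) * hfoot
    have h1 : 0 ≤ 1 - s*h/a^2 := by
      rw [sub_nonneg, div_le_one (by positivity)]; linarith
    have h2 : 0 ≤ 1 - s*h/b^2 := by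
      rw [sub_nonneg, div_le_one (by positivity)]; linarith
    nlinarith [mul_nonneg h1 (sq_nonneg (u - a^2*C)), mul_nonneg h2 (sq_nonneg (v - b^2*S))]
  · intro hsr
    have hs2 : s^2 ≤ r^2 := by
      rw [← sq_abs s]; gcongr
    set f : ℝ → ℝ := fun t => (a * cos t - p)^2 + (b * sin t - q)^2 with hf
    have hfc : Continuous f := by fun_prop
    obtain ⟨t₀, -, h1, h2⟩ := exists_ellipse_angle ha hb (w := (a^2*C, b^2*S)) (by
      simp only
      rw [← hfoot]
      field_simp)
    have hlow : f t₀ ≤ r^2 := by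
      simp only at h1 h2
      rw [hf]
      simp only
      rw [← h1, ← h2, hdist]
      exact hs2
    have hrb2 : r^2 ≤ b^2 := by gcongr
    have hhigh : ∃ t, r^2 ≤ f t := by
      rcases le_total 0 q with h0 | h0
      · refine ⟨-(π/2), ?_⟩
        simp only [hf, cos_neg, cos_pi_div_two, sin_neg, sin_pi_div_two]
        have := mul_nonneg hb.le h0
        linarith [sq_nonneg (a * 0 - p), sq_nonneg q,
          show (b * -1 - q)^2 = b^2 + 2*(b*q) + q^2 by ring]
      · refine ⟨π/2, ?_⟩
        simp only [hf, cos_pi_div_two, sin_pi_div_two]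
        have := mul_nonneg hb.le (neg_nonneg.2 h0)
        linarith [sq_nonneg (a * 0 - p), sq_nonneg q,
          show (b * 1 - q)^2 = b^2 + 2*(b*(-q)) + q^2 by ring]
    obtain ⟨t, ht⟩ := mem_range_of_exists_le_of_exists_ge hfc ⟨t₀, hlow⟩ hhigh
    refine ⟨(a * cos t, b * sin t), ?_, ht⟩
    simp only
    field_simp
    linear_combination sin_sq_add_cos_sq t

theorem volume_snd_eq (c : ℝ) : volume {x : ℝ × ℝ | x.2 = c} = 0 := by
  have : {x : ℝ × ℝ | x.2 = c} = univ ×ˢ {c} := by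
    ext x
    simp
  rw [this, Measure.volume_eq_prod, Measure.prod_prod, Real.volume_singleton, mul_zero]

/-- Signed distances up to `tubeBound` parametrize the centers of the circles meeting the
ellipse. -/
def tubeBound (a b r φ : ℝ) : ℝ := min r (b^2 / ellSupport a b φ)

/-- The contribution of the normal angle `φ` to the area of the tube around the ellipse. -/
def tubeDensity (a b r φ : ℝ) : ℝ :=
  curvRadius a b φ * (tubeBound a b r φ + r) - (tubeBound a b r φ^2 - r^2) / 2

theorem continuous_curvRadius {a b : ℝ} (ha : 0 < a) (hb : 0 < b) : Continuous (curvRadius a b) :=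
  continuous_const.div ((continuous_ellSupport a b).pow 3)
    fun φ => (pow_pos (ellSupport_pos ha hb φ) 3).ne'

theorem continuous_tubeBound {a b : ℝ} (ha : 0 < a) (hb : 0 < b) (r : ℝ) :
    Continuous (tubeBound a b r) :=
  continuous_const.min (continuous_const.div (continuous_ellSupport a b)
    fun φ => (ellSupport_pos ha hb φ).ne')

theorem continuous_tubeDensity {a b : ℝ} (ha : 0 < a) (hb : 0 < b) (r : ℝ) :
    Continuous (tubeDensity a b r) := by
  have h1 := continuous_curvRadius ha hb
  have h2 := continuous_tubeBound ha hb r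
  unfold tubeDensity
  fun_prop

theorem volume_nonempty_hitSet {a b r : ℝ} (hb : 0 < b) (hba : b < a) (hr : 0 < r)
    (hrb : r < b) :
    volume {z | (hitSet a b r z).Nonempty} =
      ENNReal.ofReal (4 * ∫ φ in (0:ℝ)..(π/2), tubeDensity a b r φ) := by
  have ha := hb.trans hba
  have hρ := continuous_curvRadius ha hb
  have hm := continuous_tubeBound ha hb r
  set D := regionBetween (fun _ => -r) (tubeBound a b r) (Ioc (-π) π) with hD
  have hDm : MeasurableSet D :=
    measurableSet_regionBetween measurable_const hm.measurable measurableSet_Ioc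
  have hDn : D ⊆ normalDomain a b := fun x hx =>
    ⟨hx.1, hx.2.2.trans_le (min_le_right _ _)⟩
  have hd : ∀ x, HasFDerivAt (normalPoint a b) (normalPointDeriv a b x) x :=
    hasFDerivAt_normalPoint ha hb
  have hnull : ∀ c, volume (normalPoint a b '' {x | x.2 = c}) = 0 := fun c =>
    addHaar_image_eq_zero_of_differentiableOn_of_addHaar_eq_zero volume
      (fun x _ => (hd x).differentiableAt.differentiableWithinAt) (volume_snd_eq c)
  have hT : volume {z | (hitSet a b r z).Nonempty} = volume (normalPoint a b '' D) := by
    refine le_antisymm ?_ (measure_mono ?_)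
    · have hsub : {z | (hitSet a b r z).Nonempty} ⊆ normalPoint a b '' D ∪ ({z | z.2 = 0} ∪
          (normalPoint a b '' {x | x.2 = r} ∪ normalPoint a b '' {x | x.2 = -r})) := by
        intro z hz
        by_cases hz0 : z.2 = 0
        · exact Or.inr (Or.inl hz0)
        obtain ⟨x, hx, rfl⟩ := exists_normalPoint hb hba hz0
        have h1 := (hitSet_normalPoint_nonempty_iff hb hba hr hrb hx.2).1 hz
        obtain ⟨h2, h3⟩ := abs_le.1 h1
        rcases h3.eq_or_lt with h4 | h4
        · exact Or.inr (Or.inr (Or.inl ⟨x, h4, rfl⟩))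
        rcases h2.eq_or_lt with h5 | h5
        · exact Or.inr (Or.inr (Or.inr ⟨x, h5.symm, rfl⟩))
        exact Or.inl ⟨x, ⟨hx.1, h5, lt_min h4 hx.2⟩, rfl⟩
      refine (measure_mono hsub).trans ((measure_union_le _ _).trans_eq ?_)
      rw [measure_union_null (volume_snd_eq 0) (measure_union_null (hnull r) (hnull (-r))), add_zero]
    · rintro _ ⟨x, hx, rfl⟩
      exact (hitSet_normalPoint_nonempty_iff hb hba hr hrb (hDn hx).2).2
        (abs_le.2 ⟨hx.2.1.le, (hx.2.2.trans_le (min_le_left _ _)).le⟩)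
  have hpos : ∀ φ, ∀ s ≤ tubeBound a b r φ, 0 ≤ curvRadius a b φ - s := fun φ s hs =>
    sub_nonneg.2 (hs.trans ((min_le_right _ _).trans (curvRadius_ge hb hba φ)))
  have hpi : -π ≤ π := by linarith [pi_pos]
  rw [hT, ← lintegral_abs_det_fderiv_eq_addHaar_image volume hDm
    (fun x _ => (hd x).hasFDerivWithinAt) ((injOn_normalPoint hb hba).mono hDn)]
  have habs : ∫⁻ x in D, ENNReal.ofReal |(normalPointDeriv a b x).det| =
      ∫⁻ x in D, ENNReal.ofReal (curvRadius a b x.1 - x.2) := by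
    refine setLIntegral_congr_fun hDm fun x hx => ?_
    rw [normalPointDeriv_det, abs_of_nonneg (hpos _ _ hx.2.2.le)]
  rw [habs, setLIntegral_of_slices hDm hpi (l := fun _ => -r) (u := tubeBound a b r)
    (fun φ => ?_) (fun x hx => hx.1) (fun φ hφ => ?_)
    (F := fun x => curvRadius a b x.1 - x.2) (G := tubeDensity a b r) (by fun_prop)
    (fun φ s hs => hpos φ s hs.2) (continuous_tubeDensity ha hb r) (fun φ => ?_),
    integral_eq_four_mul_quarter (continuous_tubeDensity ha hb r)]
  · intro φ
    simp only [tubeDensity, tubeBound, curvRadius, ellSupport_neg]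
  · intro φ
    simp only [tubeDensity, tubeBound, curvRadius, ellSupport_pi_sub]
  · have : 0 < b^2 / ellSupport a b φ := by
      have := ellSupport_pos ha hb φ
      positivity
    exact le_min (by linarith) (by linarith)
  · have : {s | (φ, s) ∈ D} = Ioo (-r) (tubeBound a b r φ) := by
      ext s
      simp only [hD, regionBetween, mem_ofPred_eq, hφ, true_and]
    rw [this]
    exact Ioo_ae_eq_Ioc
  · simp only
    rw [intervalIntegral.integral_sub (by simp) (by simp), intervalIntegral.integral_const,
      integral_id, tubeDensity, smul_eq_mul]
    ring

/-- The derivative of `ellSupport`. -/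
def ellSlope (a b φ : ℝ) : ℝ := -((a^2 - b^2) * sin φ * cos φ / ellSupport a b φ)

theorem hasDerivAt_ellSlope {a b : ℝ} (ha : 0 < a) (hb : 0 < b) (φ : ℝ) :
    HasDerivAt (ellSlope a b) (curvRadius a b φ - ellSupport a b φ) φ := by
  have hpos := ellSupport_pos ha hb φ
  have h := ((((hasDerivAt_sin φ).const_mul (a^2 - b^2)).mul (hasDerivAt_cos φ)).div
    (hasDerivAt_ellSupport ha hb φ) hpos.ne').neg
  refine h.congr_deriv ?_
  have h2 := ellSupport_sq a b φ
  have h4 : ellSupport a b φ^4 = (a^2 * cos φ^2 + b^2 * sin φ^2)^2 := by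
    rw [← h2]; ring
  simp only [curvRadius, Pi.mul_apply]
  field_simp
  rw [h4, h2]
  linear_combination a^2 * b^2 * (sin φ^2 + cos φ^2 + 1) * sin_sq_add_cos_sq φ

theorem integral_curvRadius {a b : ℝ} (hb : 0 < b) (hba : b < a) :
    ∫ φ in (0:ℝ)..(π/2), curvRadius a b φ = a * Ecomp (ecc a b) := by
  have ha := hb.trans hba
  have hc := continuous_ellSupport a b
  have hρ := continuous_curvRadius ha hb
  have h : ∫ φ in (0:ℝ)..(π/2), (curvRadius a b φ - ellSupport a b φ) =
      ellSlope a b (π/2) - ellSlope a b 0 :=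
    intervalIntegral.integral_eq_sub_of_hasDerivAt (fun φ _ => hasDerivAt_ellSlope ha hb φ)
      (Continuous.intervalIntegrable (by fun_prop) _ _)
  rw [intervalIntegral.integral_sub (hρ.intervalIntegrable _ _) (hc.intervalIntegrable _ _),
    ← mul_Einc hb hba] at h
  simp only [ellSlope, cos_pi_div_two, sin_zero, mul_zero, zero_mul, zero_div, sub_self] at h
  rw [Ecomp]
  linarith

theorem hasDerivAt_arctan_mul_tan {a b : ℝ} (ha : 0 < a) (hb : 0 < b) {φ : ℝ} (hφ : cos φ ≠ 0) :
    HasDerivAt (fun φ => arctan (b / a * tan φ)) (a * b / ellSupport a b φ^2) φ := by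
  have hpos := ellSupport_arg_pos ha hb φ
  refine (((hasDerivAt_tan hφ).const_mul (b / a)).arctan).congr_deriv ?_
  rw [ellSupport_sq, tan_eq_sin_div_cos]
  have : 1 + (b / a * (sin φ / cos φ))^2 =
      (a^2 * cos φ^2 + b^2 * sin φ^2) / (a^2 * cos φ^2) := by
    field_simp
  rw [this]
  field_simp

theorem Ffun_eq {a b : ℝ} (hb : 0 < b) (hba : b < a) (r φ : ℝ) :
    Ffun a b r φ = 2*r^2*φ + 2*a*b * arctan (b / a * tan φ)
      - 4*r * (∫ θ in (0:ℝ)..φ, ellSupport a b θ) - 2*r * ellSlope a b φ := by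
  have ha := hb.trans hba
  have hpos := ellSupport_pos ha hb φ
  rw [Ffun, ← mul_Einc hb hba, sqrt_one_sub_ecc hb hba, sq_ecc hb hba, ellSlope, sin_two_mul]
  field_simp
  ring

theorem integral_tubeDensity_left {a b r α : ℝ} (hb : 0 < b) (hba : b < a)
    (h0 : 0 ≤ α) (hα : α < π/2) (hr : r * ellSupport a b α = b^2) :
    ∫ φ in (0:ℝ)..α, 4 * (curvRadius a b φ * (b^2 / ellSupport a b φ) - curvRadius a b φ * r
      - ((b^2 / ellSupport a b φ)^2 - r^2) / 2) = Ffun a b r α := by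
  have ha := hb.trans hba
  have hc := continuous_ellSupport a b
  have hne : ∀ φ, ellSupport a b φ ≠ 0 := fun φ => (ellSupport_pos ha hb φ).ne'
  have hρ := continuous_curvRadius ha hb
  rw [intervalIntegral.integral_eq_sub_of_hasDerivAt
    (f := fun φ => 2*r^2*φ + 2*a*b * arctan (b / a * tan φ)
      - 4*r * (∫ θ in (0:ℝ)..φ, ellSupport a b θ) - 2*r * ellSlope a b φ
      - 2*r * ellSlope a b φ + 2*b^2 * (ellSlope a b φ / ellSupport a b φ)), ← Ffun_eq hb hba]
  · have h1 : ellSlope a b 0 = 0 := by simp [ellSlope]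
    have h2 : 2*b^2 * (ellSlope a b α / ellSupport a b α) = 2 * r * ellSlope a b α := by
      rw [← hr]
      have := hne α
      field_simp
    rw [h2]
    simp [h1]
  · intro φ hφ
    rw [uIcc_of_le h0] at hφ
    have hcos : cos φ ≠ 0 := (cos_pos_of_mem_Ioo ⟨by linarith [pi_pos, hφ.1], by linarith [hφ.2]⟩).ne'
    have hi : HasDerivAt (fun φ => ∫ θ in (0:ℝ)..φ, ellSupport a b θ) (ellSupport a b φ) φ :=
      intervalIntegral.integral_hasDerivAt_right (hc.intervalIntegrable _ _)
        hc.stronglyMeasurable.stronglyMeasurableAtFilter hc.continuousAt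
    have hs := hasDerivAt_ellSlope ha hb φ
    have hq := hs.div (hasDerivAt_ellSupport ha hb φ) (hne φ)
    refine (((((((hasDerivAt_id φ).const_mul (2*r^2)).add
      ((hasDerivAt_arctan_mul_tan ha hb hcos).const_mul (2*a*b))).sub (hi.const_mul (4*r))).sub
      (hs.const_mul (2*r))).sub (hs.const_mul (2*r))).add (hq.const_mul (2*b^2))).congr_deriv ?_
    have hh := ellSupport_sq a b φ
    have key : (a^2 - b^2)^2 * sin φ^2 * cos φ^2 =
        -(ellSupport a b φ^2)^2 + (a^2 + b^2) * ellSupport a b φ^2 - a^2 * b^2 := by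
      have hs' : sin φ^2 = 1 - cos φ^2 := by linarith [sin_sq_add_cos_sq φ]
      rw [hh, hs']
      ring
    have h' : ellSlope a b φ * -((a^2 - b^2) * sin φ * cos φ / ellSupport a b φ) =
        (-(ellSupport a b φ^2)^2 + (a^2 + b^2) * ellSupport a b φ^2 - a^2 * b^2) /
          ellSupport a b φ^2 := by
      rw [← key, ellSlope]
      field_simp
    rw [h', curvRadius]
    have := hne φ
    field_simp
    ring
  · have h1 : Continuous fun φ => b^2 / ellSupport a b φ := continuous_const.div hc hne
    exact Continuous.intervalIntegrable (by fun_prop) _ _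

theorem alphaAng_mem {a b r : ℝ} (hb : 0 < b) (hr1 : b^2 / a < r) (hba : b < a) (hr2 : r < b) :
    0 < alphaAng a b r ∧ alphaAng a b r < π/2 ∧ r * ellSupport a b (alphaAng a b r) = b^2 := by
  have ha := hb.trans hba
  have hr : 0 < r := lt_trans (by positivity) hr1
  have hra : b^2 < r * a := (div_lt_iff₀ ha).1 hr1
  have hT : 0 < r^2*a^2 - b^4 := by
    have : (b^2)^2 < (r*a)^2 := by gcongr
    linarith [show (b^2)^2 = b^4 by ring, show (r*a)^2 = r^2*a^2 by ring]
  have hU : 0 < b^2 - r^2 := by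
    have : r^2 < b^2 := by gcongr
    linarith
  refine ⟨arctan_pos.2 (by positivity), arctan_lt_pi_div_two _, ?_⟩
  set t := √(r^2*a^2 - b^4) / (b * √(b^2 - r^2)) with ht
  have ht2 : t^2 = (r^2*a^2 - b^4) / (b^2 * (b^2 - r^2)) := by
    rw [ht, div_pow, mul_pow, Real.sq_sqrt hT.le, Real.sq_sqrt hU.le]
  have hα : alphaAng a b r = arctan t := rfl
  have hpos := ellSupport_pos ha hb (alphaAng a b r)
  have hab : 0 < a^2 - b^2 := by nlinarith
  refine (pow_left_inj₀ (by positivity) (by positivity) two_ne_zero).1 ?_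
  have h1 : 1 + t^2 = r^2 * (a^2 - b^2) / (b^2 * (b^2 - r^2)) := by
    rw [ht2]
    field_simp
    ring
  have hc : cos (arctan t)^2 = b^2 * (b^2 - r^2) / (r^2 * (a^2 - b^2)) := by
    rw [cos_sq_arctan, h1, one_div_div]
  rw [mul_pow, ellSupport_sq, hα, sin_sq, hc]
  field_simp
  ring

theorem antitoneOn_ellSupport {a b : ℝ} (hb : 0 < b) (hba : b < a) :
    AntitoneOn (ellSupport a b) (Icc 0 (π/2)) := by
  intro x hx y hy hxy
  have hab : 0 ≤ a^2 - b^2 := by nlinarith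
  have hcos : cos y ≤ cos x := cos_le_cos_of_nonneg_of_le_pi hx.1 (by linarith [hy.2, pi_pos]) hxy
  have hcy : 0 ≤ cos y := cos_nonneg_of_mem_Icc ⟨by linarith [hy.1, pi_pos], hy.2⟩
  have h2 : cos y^2 ≤ cos x^2 := by gcongr
  refine Real.sqrt_le_sqrt ?_
  rw [sin_sq, sin_sq]
  linarith [mul_le_mul_of_nonneg_left h2 hab]

theorem volume_nonempty_hitSet_eq {a b r : ℝ} (hb : 0 < b) (hba : b < a) (hr1 : b^2 / a < r)
    (hr2 : r < b) :
    volume {z | (hitSet a b r z).Nonempty} =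
      ENNReal.ofReal (8*r*a * Ecomp (ecc a b) + Ffun a b r (alphaAng a b r)) := by
  have ha := hb.trans hba
  have hr : 0 < r := lt_trans (by positivity) hr1
  obtain ⟨h0, hα, hrα⟩ := alphaAng_mem hb hr1 hba hr2
  rw [volume_nonempty_hitSet hb hba hr hr2]
  congr 1
  set α := alphaAng a b r
  have hpos := ellSupport_pos ha hb
  have hρ := continuous_curvRadius ha hb
  have hG := continuous_tubeDensity ha hb r
  have hleft : ∫ φ in (0:ℝ)..α, (tubeDensity a b r φ - 2*r * curvRadius a b φ) =
      ∫ φ in (0:ℝ)..α, (1/4) * (4 * (curvRadius a b φ * (b^2 / ellSupport a b φ)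
        - curvRadius a b φ * r - ((b^2 / ellSupport a b φ)^2 - r^2) / 2)) := by
    refine intervalIntegral.integral_congr fun φ hφ => ?_
    rw [uIcc_of_le h0.le] at hφ
    have hm : tubeBound a b r φ = b^2 / ellSupport a b φ := by
      refine min_eq_right ((div_le_iff₀ (hpos φ)).2 ?_)
      rw [← hrα]
      gcongr
      exact antitoneOn_ellSupport hb hba ⟨hφ.1, hφ.2.trans hα.le⟩ ⟨h0.le, hα.le⟩ hφ.2
    simp only [tubeDensity, hm]
    ring
  have hright : ∫ φ in α..(π/2), (tubeDensity a b r φ - 2*r * curvRadius a b φ) =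
      ∫ φ in α..(π/2), (0:ℝ) := by
    refine intervalIntegral.integral_congr fun φ hφ => ?_
    rw [uIcc_of_le hα.le] at hφ
    have hm : tubeBound a b r φ = r := by
      refine min_eq_left ((le_div_iff₀ (hpos φ)).2 ?_)
      rw [← hrα]
      gcongr
      exact antitoneOn_ellSupport hb hba ⟨h0.le, hα.le⟩ ⟨h0.le.trans hφ.1, hφ.2⟩ hφ.1
    simp only [tubeDensity, hm]
    ring
  have hint : ∀ c d, IntervalIntegrable (fun φ => tubeDensity a b r φ - 2*r * curvRadius a b φ)
      volume c d := fun c d => Continuous.intervalIntegrable (by fun_prop) _ _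
  have hsum := intervalIntegral.integral_add_adjacent_intervals (hint 0 α) (hint α (π/2))
  rw [hleft, hright, intervalIntegral.integral_zero, intervalIntegral.integral_const_mul,
    integral_tubeDensity_left hb hba h0.le hα hrα,
    intervalIntegral.integral_sub (hG.intervalIntegrable _ _)
      (Continuous.intervalIntegrable (by fun_prop) _ _), intervalIntegral.integral_const_mul,
    integral_curvRadius hb hba] at hsum
  linarith

theorem volume_ncard_hitSet_eq_two {a b r : ℝ} (hb : 0 < b) (hba : b < a) (hr1 : b^2 / a < r)
    (hr2 : r < b) :
    volume {z | (hitSet a b r z).ncard = 2} =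
      ENNReal.ofReal (8*r*a * Ecomp (ecc a b) + 2 * Ffun a b r (alphaAng a b r)) := by
  have ha := hb.trans hba
  have hr : 0 < r := lt_trans (by positivity) hr1
  set t := {z | (hitSet a b r z).Nonempty} with ht
  set N : ℝ × ℝ → ENNReal :=
    fun z => Measure.count (transversal a b r ∩ circleCenter a b r ⁻¹' {z}) with hN
  obtain ⟨hNm, hNi⟩ := lintegral_count_fiber (μ := volume)
    (measurableSet_transversal a b r) (fun x _ => hasFDerivAt_circleCenter a b r x)
    (fun x hx => hx.2)
  rw [setLIntegral_transversal hb hba hr] at hNi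
  have hae := ae_count_circleCenter ha hb hr
  have hA : {z | (hitSet a b r z).ncard = 2} =ᵐ[volume] {z | N z = 2} := by
    filter_upwards [hae] with z hz
    refine propext ?_
    change (hitSet a b r z).ncard = 2 ↔ N z = 2
    rw [hN]
    simp only
    rw [hz.1]
    norm_cast
  have hT : t =ᵐ[volume] {z | N z ≠ 0} := by
    filter_upwards [hae] with z hz
    refine propext ?_
    change (hitSet a b r z).Nonempty ↔ N z ≠ 0
    rw [hN]
    simp only
    rw [hz.1, ← ncard_pos hz.2.2.2]
    norm_cast
    omega
  have hm2 : MeasurableSet {z | N z = 2} := hNm (measurableSet_singleton 2)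
  have hm0 : MeasurableSet {z | N z ≠ 0} := (hNm (measurableSet_singleton 0)).compl
  have hid : ∫⁻ z, (2 * {z | N z = 2}.indicator 1 z + N z) =
      ∫⁻ z, 4 * {z | N z ≠ 0}.indicator 1 z := by
    refine lintegral_congr_ae ?_
    filter_upwards [hae] with z hz
    have h1 : N z = ((hitSet a b r z).ncard : ENNReal) := hz.1
    simp only [indicator_apply, mem_ofPred_eq, h1, Pi.one_apply]
    obtain ⟨k, hk⟩ := hz.2.1
    have h4 := hz.2.2.1
    generalize (hitSet a b r z).ncard = n at *
    have : n = 0 ∨ n = 2 ∨ n = 4 := by omega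
    rcases this with rfl | rfl | rfl
    · simp
    · norm_num
    · norm_num
  have hi2 : Measurable ({z | N z = 2}.indicator (1 : ℝ × ℝ → ENNReal)) :=
    measurable_one.indicator hm2
  have hi0 : Measurable ({z | N z ≠ 0}.indicator (1 : ℝ × ℝ → ENNReal)) :=
    measurable_one.indicator hm0
  rw [lintegral_add_right _ hNm, lintegral_const_mul _ hi2, lintegral_const_mul _ hi0,
    lintegral_indicator_one hm2, lintegral_indicator_one hm0, hNi, ← measure_congr hA,
    ← measure_congr hT, ht, volume_nonempty_hitSet_eq hb hba hr1 hr2] at hid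
  have hE : 0 ≤ 16*r*a * Ecomp (ecc a b) := by
    have : 0 ≤ Ecomp (ecc a b) :=
      intervalIntegral.integral_nonneg (by positivity) fun _ _ => Real.sqrt_nonneg _
    positivity
  generalize volume {z | (hitSet a b r z).ncard = 2} = V at hid ⊢
  generalize Ffun a b r (alphaAng a b r) = F at hid ⊢
  generalize Ecomp (ecc a b) = E at hid hE ⊢
  have hV : V ≠ ⊤ := by
    rintro rfl
    rw [ENNReal.mul_top two_ne_zero, top_add] at hid
    exact ENNReal.mul_ne_top (by simp) ENNReal.ofReal_ne_top hid.symm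
  obtain ⟨v, hv, rfl⟩ : ∃ v : ℝ, 0 ≤ v ∧ V = ENNReal.ofReal v :=
    ⟨V.toReal, ENNReal.toReal_nonneg, (ENNReal.ofReal_toReal hV).symm⟩
  rw [show (2 : ENNReal) = ENNReal.ofReal 2 by simp, show (4 : ENNReal) = ENNReal.ofReal 4 by simp,
    ← ENNReal.ofReal_mul zero_le_two, ← ENNReal.ofReal_mul zero_le_four,
    ← ENNReal.ofReal_add (by positivity) hE] at hid
  rcases le_or_gt 0 (8*r*a*E + F) with h0 | h0
  · rw [ENNReal.ofReal_eq_ofReal_iff (by positivity) (by positivity)] at hid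
    congr 1
    linarith
  · rw [ENNReal.ofReal_of_nonpos (p := 4 * _) (by linarith), ENNReal.ofReal_eq_zero] at hid
    rw [ENNReal.ofReal_of_nonpos (by linarith), ENNReal.ofReal_of_nonpos (by linarith)]

theorem ncard_sphere_inter_Cset {r : ℝ} (hr : 0 ≤ r) (a b : ℝ) (x : E2) :
    (sphere x r ∩ Cset a b).ncard = (hitSet a b r (x 0, x 1)).ncard := by
  have hinj : InjOn (fun y : E2 => (y 0, y 1)) (sphere x r ∩ Cset a b) := by
    intro y _ z _ h
    ext i
    fin_cases i
    · exact congrArg Prod.fst h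
    · exact congrArg Prod.snd h
  rw [← hinj.ncard_image]
  congr 1
  have hdist : ∀ y : E2, dist y x = r ↔ (y 0 - x 0)^2 + (y 1 - x 1)^2 = r^2 := fun y => by
    rw [EuclideanSpace.dist_eq, Fin.sum_univ_two, Real.dist_eq, Real.dist_eq, sq_abs, sq_abs,
      Real.sqrt_eq_iff_eq_sq (by positivity) hr]
  ext w
  constructor
  · rintro ⟨y, ⟨hy1, hy2⟩, rfl⟩
    exact ⟨hy2, (hdist y).1 hy1⟩
  · rintro ⟨hw1, hw2⟩
    refine ⟨!₂[w.1, w.2], ⟨?_, ?_⟩, rfl⟩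
    · exact (hdist _).2 hw2
    · exact hw1

theorem measurePreserving_coords : MeasurePreserving (fun x : E2 => (x 0, x 1)) :=
  (volume_preserving_finTwoArrow ℝ).comp (PiLp.volume_preserving_ofLp (Fin 2))

/-- Case 2 of Lemma 1: for `b²/a < r < b`, the area of the set of centers `x` for which the
circle of radius `r` about `x` meets the ellipse in exactly two points is
`2πr² + 2πab − 2(A* − F(α))`. -/
theorem area_two_intersections_case2 (a b r : ℝ) (hb : 0 < b) (hba : b < a)
    (hr1 : b^2 / a < r) (hr2 : r < b) :
    volume {x : E2 | (sphere x r ∩ Cset a b).ncard = 2} =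
      ENNReal.ofReal (2*π*r^2 + 2*π*a*b - 2*(Astar a b r - Ffun a b r (alphaAng a b r))) := by
  have hr : 0 < r := lt_trans (div_pos (pow_pos hb 2) (hb.trans hba)) hr1
  have hemb : MeasurableEmbedding (fun x : E2 => (x 0, x 1)) :=
    (MeasurableEquiv.finTwoArrow (α := ℝ)).measurableEmbedding.comp
      (MeasurableEquiv.toLp 2 (Fin 2 → ℝ)).symm.measurableEmbedding
  simp_rw [ncard_sphere_inter_Cset hr.le]
  rw [← preimage_ofPred_eq (p := fun z => (hitSet a b r z).ncard = 2),
    measurePreserving_coords.measure_preimage_emb hemb,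
    volume_ncard_hitSet_eq_two hb hba hr1 hr2, Astar]
  congr 1
  ring
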